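/- If a quasi order Q is BQO, then H_f(Q) is BQO. -/

import Mathlib

/-- Hereditarily finite sets with urelements from `Q`. -/
inductive HF (Q : Type*) where
  | ur : Q → HF Q
  | set : List (HF Q) → HF Q

namespace HF

/-- The quasi order on `HF Q`. -/
def le {Q : Type*} [LE Q] : HF Q → HF Q → Prop
  | .ur p, .ur q => p ≤ q
  | .ur p, .set b => ∃ y, ∃ _ : y ∈ b, le (.ur p) y
  | .set a, .ur q => ∀ x, x ∈ a → le x (.ur q)
  | .set a, .set b => ∀ x, x ∈ a → ∃ y, ∃ _ : y ∈ b, le x y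
termination_by x y => sizeOf x + sizeOf y
decreasing_by
  all_goals simp_wf
  · have := List.sizeOf_lt_of_mem ‹_ ∈ b›; omega
  · have := List.sizeOf_lt_of_mem ‹_ ∈ a›; omega
  · have h1 := List.sizeOf_lt_of_mem ‹_ ∈ a›
    have h2 := List.sizeOf_lt_of_mem ‹_ ∈ b›; omega

/-- The support of an element of `HF Q`: the list of urelements occurring in it. -/
def supp {Q : Type*} : HF Q → List Q
  | .ur q => [q]
  | .set a => a.attach.flatMap (fun x => supp x.1)
termination_by x => sizeOf x
decreasing_by
  simp_wf
  have := List.sizeOf_lt_of_mem x.2; omega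

end HF

/-- `s` is a finite strictly increasing sequence of naturals. -/
def IncrList (s : List ℕ) : Prop := s.Chain' (· < ·)

/-- `s` is an initial segment of the increasing enumeration of the infinite set
enumerated by the strictly monotone `g`. -/
def InitSegOf (s : List ℕ) (g : ℕ → ℕ) : Prop := s = (List.range s.length).map g

/-- The relation `s ⊲ t`. -/
def TriRel (s t : List ℕ) : Prop :=
  ∃ g : ℕ → ℕ, StrictMono g ∧ InitSegOf s g ∧ InitSegOf t (fun i => g (i + 1))

/-- `B` is a block with base `ℕ`. -/
def IsBlock (B : Set (List ℕ)) : Prop :=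
  (∀ s ∈ B, IncrList s ∧ s ≠ []) ∧
  ∀ g : ℕ → ℕ, StrictMono g → ∃! n : ℕ, (List.range n).map g ∈ B

/-- `B` is a barrier with base `ℕ`. -/
def IsBarrier (B : Set (List ℕ)) : Prop :=
  IsBlock B ∧ ∀ s ∈ B, ∀ t ∈ B, s ≠ t → ¬ (∀ x ∈ s, x ∈ t)

/-- The array given by the values of `f` on `B` is good for the quasi order `r`. -/
def GoodArr {Q : Type*} (r : Q → Q → Prop) (B : Set (List ℕ)) (f : List ℕ → Q) : Prop :=
  ∃ s ∈ B, ∃ t ∈ B, TriRel s t ∧ r (f s) (f t)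

/-- The quasi order `r` is a better quasi order: every array on every barrier is good. -/
def IsBQO {Q : Type*} (r : Q → Q → Prop) : Prop :=
  ∀ B : Set (List ℕ), IsBarrier B → ∀ f : List ℕ → Q, GoodArr r B f

namespace HFProof

/-- shift -/
def sh (X : ℕ → ℕ) : ℕ → ℕ := fun i => X (i + 1)

/-- prefix -/
def pfx (X : ℕ → ℕ) (n : ℕ) : List ℕ := (List.range n).map X

/-- cons -/
def cns (n : ℕ) (X : ℕ → ℕ) : ℕ → ℕ
  | 0 => n
  | i + 1 => X i

lemma sh_mono {X : ℕ → ℕ} (h : StrictMono X) : StrictMono (sh X) :=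
  fun _ _ hab => h (Nat.add_lt_add_right hab 1)

lemma cns_sh (X : ℕ → ℕ) : cns (X 0) (sh X) = X := by
  funext i; cases i <;> rfl

lemma pfx_eq {X Y : ℕ → ℕ} {n m : ℕ} (h : pfx X n = pfx Y m) :
    n = m ∧ ∀ i < n, X i = Y i := by
  have hl : n = m := by simpa [pfx] using congrArg List.length h
  subst hl
  refine ⟨rfl, fun i hi => ?_⟩
  have := List.map_inj_left.1 h i (by simpa using hi)
  exact this

lemma pfx_congr {X Y : ℕ → ℕ} {n : ℕ} (h : ∀ i < n, X i = Y i) : pfx X n = pfx Y n := by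
  apply List.map_congr_left
  intro i hi
  exact h i (by simpa using hi)

/-- barrier length function -/
def Bar (L : (ℕ → ℕ) → ℕ) : Prop :=
  ∀ X Y : ℕ → ℕ, StrictMono X → StrictMono Y →
    (∀ i < L X, ∃ j < L Y, X i = Y j) → L Y ≤ L X

lemma bar_const (c : ℕ) : Bar (fun _ => c) := fun _ _ _ _ _ => le_rfl

lemma bar_max {L M : (ℕ → ℕ) → ℕ} (hL : Bar L) (hM : Bar M) :
    Bar (fun X => max (L X) (M X)) := by
  intro X Y hX hY h
  -- elements of X below L X lie among elements of Y, by monotonicity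
  simp only at h ⊢
  rcases le_total (L Y) (M Y) with hle | hle
  · rw [max_eq_right hle] at h ⊢
    exact (hM X Y hX hY (fun i hi => h i (lt_of_lt_of_le hi (le_max_right _ _)))).trans
      (le_max_right _ _)
  · rw [max_eq_left hle] at h ⊢
    exact (hL X Y hX hY (fun i hi => h i (lt_of_lt_of_le hi (le_max_left _ _)))).trans
      (le_max_left _ _)

/-- running max -/
def rmax (L : ℕ → (ℕ → ℕ) → ℕ) : ℕ → (ℕ → ℕ) → ℕ
  | 0 => L 0
  | n + 1 => fun X => max (rmax L n X) (L (n + 1) X)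

lemma bar_rmax {L : ℕ → (ℕ → ℕ) → ℕ} (hL : ∀ n, Bar (L n)) (n : ℕ) : Bar (rmax L n) := by
  induction n with
  | zero => exact hL 0
  | succ n ih => exact bar_max ih (hL (n + 1))

lemma rmax_mono (L : ℕ → (ℕ → ℕ) → ℕ) (X : ℕ → ℕ) : Monotone (fun n => rmax L n X) :=
  monotone_nat_of_le_succ (fun _ => le_max_left _ _)

lemma le_rmax (L : ℕ → (ℕ → ℕ) → ℕ) (X : ℕ → ℕ) (n : ℕ) : L n X ≤ rmax L n X := by
  cases n with
  | zero => exact le_rfl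
  | succ n => exact le_max_right _ _

lemma bar_node {L : ℕ → (ℕ → ℕ) → ℕ} (hL : ∀ n, Bar (L n)) :
    Bar (fun X => rmax L (X 0) (sh X) + 1) := by
  intro X Y hX hY h
  simp only at h ⊢
  have h0 : Y 0 ≤ X 0 := by
    obtain ⟨j, _, hj⟩ := h 0 (Nat.succ_pos _)
    rw [hj]; exact hY.monotone (Nat.zero_le _)
  have hm : rmax L (Y 0) (sh X) ≤ rmax L (X 0) (sh X) := rmax_mono L (sh X) h0
  have key : rmax L (Y 0) (sh Y) ≤ rmax L (Y 0) (sh X) := by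
    apply bar_rmax hL (Y 0) (sh X) (sh Y) (sh_mono hX) (sh_mono hY)
    intro i hi
    obtain ⟨j, hj, hij⟩ := h (i + 1) (by omega)
    have hlt : X 0 < X (i + 1) := hX (Nat.succ_pos i)
    cases j with
    | zero => omega
    | succ j => exact ⟨j, by omega, hij⟩
  omega

/-- inductive determinacy -/
inductive Det {α : Type*} : ((ℕ → ℕ) → α) → Prop
  | const (H : (ℕ → ℕ) → α) (h : ∀ X Y, H X = H Y) : Det H
  | node (H : (ℕ → ℕ) → α) (h : ∀ n, Det (fun X => H (cns n X))) : Det H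

lemma det_bar {α : Type*} {H : (ℕ → ℕ) → α} (h : Det H) :
    ∃ L, Bar L ∧ ∀ X Y : ℕ → ℕ, (∀ i < L X, X i = Y i) → H X = H Y := by
  induction h with
  | const H h => exact ⟨_, bar_const 0, fun X Y _ => h X Y⟩
  | node H h ih =>
    choose L hL hd using ih
    refine ⟨_, bar_node hL, fun X Y hXY => ?_⟩
    have h0 : X 0 = Y 0 := hXY 0 (Nat.succ_pos _)
    rw [← cns_sh X, ← cns_sh Y, ← h0]
    apply hd (X 0) (sh X) (sh Y)
    intro i hi
    have := le_rmax L (sh X) (X 0)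
    exact hXY (i + 1) (by omega)

lemma det_of_loc {α : Type*} {H : (ℕ → ℕ) → α}
    (h : ∀ X, ∃ n, ∀ Y, (∀ i < n, X i = Y i) → H Y = H X) : Det H := by
  by_contra hH
  have step : ∀ K : {K : (ℕ → ℕ) → α // ¬ Det K}, ∃ n, ¬ Det (fun X => K.1 (cns n X)) := by
    intro K
    by_contra hc
    push Not at hc
    exact K.2 (Det.node _ hc)
  choose c hc using step
  let K : ℕ → {K : (ℕ → ℕ) → α // ¬ Det K} := fun i =>
    Nat.rec ⟨H, hH⟩ (fun _ K => ⟨_, hc K⟩) i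
  let X : ℕ → ℕ := fun i => c (K i)
  have hK : ∀ i Y, (K i).1 Y = H (fun j => if j < i then X j else Y (j - i)) := by
    intro i
    induction i with
    | zero => intro Y; simp [K]
    | succ i ih =>
      intro Y
      have : (K (i + 1)).1 Y = (K i).1 (cns (X i) Y) := rfl
      rw [this, ih]
      congr 1
      funext j
      by_cases h1 : j < i
      · simp [h1, Nat.lt_succ_of_lt h1]
      · by_cases h2 : j = i
        · subst h2; simp [cns]
        · obtain ⟨k, rfl⟩ : ∃ k, j = i + 1 + k := ⟨j - (i + 1), by omega⟩
          have e : i + 1 + k - i = k + 1 := by omega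
          have e2 : i + 1 + k - (i + 1) = k := by omega
          rw [if_neg h1, if_neg (by omega), e, e2]; rfl
  obtain ⟨n, hn⟩ := h X
  apply (K n).2
  apply Det.const
  intro Y Z
  have e : ∀ W, (K n).1 W = H X := by
    intro W
    rw [hK]
    apply hn
    intro i hi
    rw [if_pos hi]
  exact (e Y).trans (e Z).symm

/-- retraction onto strictly increasing sequences -/
def ret (X : ℕ → ℕ) : ℕ → ℕ
  | 0 => X 0
  | i + 1 => max (X (i + 1)) (ret X i + 1)

lemma ret_mono (X : ℕ → ℕ) : StrictMono (ret X) :=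
  strictMono_nat_of_lt_succ (fun n => lt_of_lt_of_le (Nat.lt_succ_self _) (le_max_right _ _))

lemma ret_id {X : ℕ → ℕ} (h : StrictMono X) : ret X = X := by
  funext i
  induction i with
  | zero => rfl
  | succ i ih =>
    have : X i < X (i + 1) := h (Nat.lt_succ_self i)
    simp only [ret, ih]; omega

lemma ret_congr {X Y : ℕ → ℕ} {n : ℕ} (h : ∀ i < n, X i = Y i) :
    ∀ i < n, ret X i = ret Y i := by
  intro i
  induction i with
  | zero => exact h 0
  | succ i ih =>
    intro hi
    simp only [ret, h _ hi, ih (by omega)]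

/-- local constancy on strictly increasing sequences -/
def Loc {α : Type*} (G : (ℕ → ℕ) → α) : Prop :=
  ∀ X, StrictMono X → ∃ n, ∀ Y, StrictMono Y → (∀ i < n, X i = Y i) → G Y = G X

lemma loc_bar {α : Type*} {G : (ℕ → ℕ) → α} (h : Loc G) :
    ∃ L, Bar L ∧ (∀ X, 1 ≤ L X) ∧ ∀ X Y : ℕ → ℕ, StrictMono X → StrictMono Y →
      (∀ i < L X, X i = Y i) → G X = G Y := by
  have hd : Det (fun X => G (ret X)) := by
    apply det_of_loc
    intro X
    obtain ⟨n, hn⟩ := h (ret X) (ret_mono X)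
    exact ⟨n, fun Y hY => hn (ret Y) (ret_mono Y) (ret_congr hY)⟩
  obtain ⟨L, hL, hH⟩ := det_bar hd
  refine ⟨_, bar_max hL (bar_const 1), fun X => le_max_right _ _, fun X Y hX hY hXY => ?_⟩
  have := hH X Y (fun i hi => hXY i (lt_of_lt_of_le hi (le_max_left _ _)))
  simpa only [ret_id hX, ret_id hY] using this

lemma bar_agree {L : (ℕ → ℕ) → ℕ} (hL : Bar L) {X Y : ℕ → ℕ} (hX : StrictMono X)
    (hY : StrictMono Y) (h : ∀ i < L X, X i = Y i) : L X = L Y := by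
  rcases le_total (L X) (L Y) with hle | hle
  · exact le_antisymm hle
      (hL X Y hX hY (fun i hi => ⟨i, lt_of_lt_of_le hi hle, h i hi⟩))
  · exact le_antisymm
      (hL Y X hY hX (fun i hi => ⟨i, lt_of_lt_of_le hi hle, (h i (lt_of_lt_of_le hi hle)).symm⟩))
      hle

lemma pfx_sorted {X : ℕ → ℕ} (hX : StrictMono X) (n : ℕ) : (pfx X n).Pairwise (· < ·) := by
  unfold pfx
  rw [List.pairwise_map]
  exact List.pairwise_lt_range.imp (fun h => hX h)

lemma isBarrier_of_bar {L : (ℕ → ℕ) → ℕ} (hL : Bar L) (h1 : ∀ X, 1 ≤ L X) :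
    IsBarrier {s | ∃ X, StrictMono X ∧ s = pfx X (L X)} := by
  refine ⟨⟨?_, ?_⟩, ?_⟩
  · rintro s ⟨X, hX, rfl⟩
    refine ⟨(pfx_sorted hX _).isChain, ?_⟩
    have := h1 X
    intro h
    have := congrArg List.length h
    simp [pfx] at this
    omega
  · intro g hg
    refine ⟨L g, ⟨g, hg, rfl⟩, ?_⟩
    rintro n ⟨X, hX, h⟩
    obtain ⟨e, hi⟩ := pfx_eq (X := g) (Y := X) h
    rw [e] at hi ⊢
    exact bar_agree hL hX hg (fun i hh => (hi i hh).symm)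
  · rintro s ⟨X, hX, rfl⟩ t ⟨Y, hY, rfl⟩ hne hsub
    apply hne
    have hle : L Y ≤ L X := by
      apply hL X Y hX hY
      intro i hi
      have := hsub (X i) (by simp only [pfx, List.mem_map, List.mem_range]; exact ⟨i, hi, rfl⟩)
      simp only [pfx, List.mem_map, List.mem_range] at this
      obtain ⟨j, hj, e⟩ := this
      exact ⟨j, hj, e.symm⟩
    have sX := pfx_sorted hX (L X)
    have sY := pfx_sorted hY (L Y)
    have nX : (pfx X (L X)).Nodup := sX.imp (fun h => h.ne)
    have hp : (pfx X (L X)).Perm (pfx Y (L Y)) :=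
      (nX.subperm hsub).perm_of_length_le (by simpa [pfx] using hle)
    exact hp.eq_of_pairwise (fun a b _ _ h h' => absurd (h.trans h') (lt_irrefl _)) sX sY

lemma bqo_loc {Q : Type*} {r : Q → Q → Prop} (hQ : IsBQO r) {G : (ℕ → ℕ) → Q} (hG : Loc G) :
    ∃ X, StrictMono X ∧ r (G X) (G (sh X)) := by
  classical
  obtain ⟨L, hL, h1, hd⟩ := loc_bar hG
  have hB := isBarrier_of_bar hL h1
  let f : List ℕ → Q := fun s =>
    if h : ∃ X, StrictMono X ∧ s = pfx X (L X) then G h.choose else G id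
  have hf : ∀ X, StrictMono X → f (pfx X (L X)) = G X := by
    intro X hX
    have h : ∃ Y, StrictMono Y ∧ pfx X (L X) = pfx Y (L Y) := ⟨X, hX, rfl⟩
    simp only [f, dif_pos h]
    exact (hd X _ hX h.choose_spec.1 (pfx_eq h.choose_spec.2).2).symm
  have hu : ∀ X n, StrictMono X → pfx X n ∈ {s | ∃ X, StrictMono X ∧ s = pfx X (L X)} →
      n = L X := by
    intro X n hX hn
    exact (hB.1.2 X hX).unique hn ⟨X, hX, rfl⟩
  obtain ⟨s, hs, t, ht, ⟨g, hg, es, et⟩, hr⟩ := hQ _ hB f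
  refine ⟨g, hg, ?_⟩
  have es' : s = pfx g s.length := es
  have et' : t = pfx (sh g) t.length := et
  have ls := hu g s.length hg (es' ▸ hs)
  have lt := hu (sh g) t.length (sh_mono hg) (et' ▸ ht)
  rw [ls] at es'
  rw [lt] at et'
  rwa [es', et', hf g hg, hf _ (sh_mono hg)] at hr

/-- child relation -/
def Ch {Q : Type*} (y : HF Q) : HF Q → Prop
  | .ur q => y = .ur q
  | .set l => y ∈ l

lemma exists_child {Q : Type*} [LE Q] (a b : HF Q) (h : ¬ HF.le a b) :
    ∃ x, Ch x a ∧ ∀ y, Ch y b → ¬ HF.le x y := by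
  cases a with
  | ur p =>
    refine ⟨.ur p, rfl, fun y hy hle => h ?_⟩
    cases b with
    | ur q => cases (show y = .ur q from hy); exact hle
    | set l => rw [HF.le]; exact ⟨y, hy, hle⟩
  | set a =>
    cases b with
    | ur q =>
      rw [HF.le] at h
      push Not at h
      obtain ⟨x, hx, hn⟩ := h
      exact ⟨x, hx, fun y hy => (show y = .ur q from hy) ▸ hn⟩
    | set l =>
      rw [HF.le] at h
      push Not at h
      obtain ⟨x, hx, hn⟩ := h
      exact ⟨x, hx, fun y hy => hn y hy⟩

/-- bad continuous arrays -/
def BadLoc {Q : Type*} [LE Q] (F : (ℕ → ℕ) → HF Q) : Prop :=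
  Loc F ∧ ∀ X, StrictMono X → ¬ HF.le (F X) (F (sh X))

lemma bad_step {Q : Type*} [LE Q] (F : (ℕ → ℕ) → HF Q) (hF : BadLoc F) :
    ∃ F' : (ℕ → ℕ) → HF Q, BadLoc F' ∧ ∀ X, StrictMono X → Ch (F' X) (F X) := by
  classical
  let φ : HF Q → HF Q → HF Q := fun a b =>
    if h : ¬ HF.le a b then (exists_child a b h).choose else a
  have hφ : ∀ a b, ¬ HF.le a b → Ch (φ a b) a ∧ ∀ y, Ch y b → ¬ HF.le (φ a b) y := by
    intro a b h
    simp only [φ, dif_pos h]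
    exact (exists_child a b h).choose_spec
  refine ⟨fun X => φ (F X) (F (sh X)), ⟨?_, ?_⟩, fun X hX => (hφ _ _ (hF.2 X hX)).1⟩
  · intro X hX
    obtain ⟨n, hn⟩ := hF.1 X hX
    obtain ⟨m, hm⟩ := hF.1 (sh X) (sh_mono hX)
    refine ⟨n + m + 1, fun Y hY h => ?_⟩
    simp only
    rw [hn Y hY (fun i hi => h i (by omega)),
      hm (sh Y) (sh_mono hY) (fun i hi => h (i + 1) (by omega))]
  · intro X hX
    exact (hφ _ _ (hF.2 X hX)).2 _ (hφ _ _ (hF.2 (sh X) (sh_mono hX))).1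

end HFProof

open HFProof

theorem stmt10 {Q : Type*} [Preorder Q]
    (hQ : IsBQO ((· ≤ ·) : Q → Q → Prop)) :
    IsBQO (HF.le (Q := Q)) := by
  classical
  intro B hB f
  by_contra hbad
  -- initial array
  have hex : ∀ X : ℕ → ℕ, ∃ n, StrictMono X → pfx X n ∈ B := by
    intro X
    by_cases hX : StrictMono X
    · obtain ⟨n, hn, _⟩ := hB.1.2 X hX
      exact ⟨n, fun _ => hn⟩
    · exact ⟨0, fun h => absurd h hX⟩
  choose N hN using hex
  let F₀ : (ℕ → ℕ) → HF Q := fun X => f (pfx X (N X))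
  have hF₀ : BadLoc F₀ := by
    constructor
    · intro X hX
      refine ⟨N X, fun Y hY h => ?_⟩
      have e := pfx_congr h
      have : N Y = N X := (hB.1.2 Y hY).unique (hN Y hY)
        (show pfx Y (N X) ∈ B from e ▸ hN X hX)
      simp only [F₀, this, e]
    · intro X hX hle
      apply hbad
      refine ⟨_, hN X hX, _, hN (sh X) (sh_mono hX), ⟨X, hX, ?_, ?_⟩, hle⟩
      · simp [InitSegOf, pfx]
      · simp [InitSegOf, pfx, sh]
  -- iterate
  have hs : ∀ F : {F : (ℕ → ℕ) → HF Q // BadLoc F}, ∃ F' : {F : (ℕ → ℕ) → HF Q // BadLoc F},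
      ∀ X, StrictMono X → Ch (F'.1 X) (F.1 X) := by
    intro F
    obtain ⟨F', h, h'⟩ := bad_step F.1 F.2
    exact ⟨⟨F', h⟩, h'⟩
  choose S hS using hs
  let F : ℕ → {F : (ℕ → ℕ) → HF Q // BadLoc F} := fun n =>
    Nat.rec ⟨F₀, hF₀⟩ (fun _ F => S F) n
  have hF : ∀ n X, StrictMono X → Ch ((F (n + 1)).1 X) ((F n).1 X) := fun n => hS (F n)
  have hstay : ∀ X, StrictMono X → ∀ q n, (F n).1 X = .ur q → ∀ m, n ≤ m →
      (F m).1 X = .ur q := by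
    intro X hX q n hn m hm
    induction m, hm using Nat.le_induction with
    | base => exact hn
    | succ m _ ih =>
      have := hF m X hX
      rw [ih] at this
      exact this
  have hterm : ∀ X, StrictMono X → ∃ q n, (F n).1 X = .ur q := by
    intro X hX
    by_contra hc
    push Not at hc
    have hlt : ∀ n, sizeOf ((F (n + 1)).1 X) < sizeOf ((F n).1 X) := by
      intro n
      have h := hF n X hX
      cases e : (F n).1 X with
      | ur q => exact absurd e (hc q n)
      | set l =>
        rw [e] at h
        have := List.sizeOf_lt_of_mem (show _ ∈ l from h)
        simp only [HF.set.sizeOf_spec]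
        omega
    have hle : ∀ n, sizeOf ((F n).1 X) + n ≤ sizeOf ((F 0).1 X) := by
      intro n
      induction n with
      | zero => exact le_rfl
      | succ n ih => have := hlt n; omega
    have h1 := hle (sizeOf ((F 0).1 X) + 1)
    omega
  obtain ⟨q₀, -⟩ := hterm id strictMono_id
  have hG : ∀ X, ∃ q, StrictMono X → ∃ n, (F n).1 X = .ur q := by
    intro X
    by_cases hX : StrictMono X
    · obtain ⟨q, h⟩ := hterm X hX
      exact ⟨q, fun _ => h⟩
    · exact ⟨q₀, fun h => absurd h hX⟩
  choose G hG using hG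
  have hGl : Loc G := by
    intro X hX
    obtain ⟨n, hn⟩ := hG X hX
    obtain ⟨k, hk⟩ := (F n).2.1 X hX
    refine ⟨k, fun Y hY h => ?_⟩
    obtain ⟨m, hm⟩ := hG Y hY
    have e1 := hstay Y hY _ n ((hk Y hY h).trans hn) (max n m) (le_max_left _ _)
    have e2 := hstay Y hY _ m hm (max n m) (le_max_right _ _)
    rw [e1] at e2
    exact (HF.ur.inj e2).symm
  obtain ⟨X, hX, hr⟩ := bqo_loc hQ hGl
  obtain ⟨n, hn⟩ := hG X hX
  obtain ⟨m, hm⟩ := hG (sh X) (sh_mono hX)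
  have e1 := hstay X hX _ n hn (max n m) (le_max_left _ _)
  have e2 := hstay (sh X) (sh_mono hX) _ m hm (max n m) (le_max_right _ _)
  apply (F (max n m)).2.2 X hX
  rw [e1, e2, HF.le]
  exact hr
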